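/- arXiv:2408.06917 — 2 statements merged into one kernel-verified Lean document; each statement's English description precedes it below -/
import Mathlib

section
/- Milnor–Moore/Friedrichs theorem (unit isomorphism, Theorem "Mil", full-faithfulness part): Let K be a field of characteristic zero and L a Lie algebra over K. Equip the universal enveloping algebra U(L) with its standard bialgebra structure. Then the canonical map ι : L → U(L) is injective, and its range is exactly the set of primitive elements of U(L); equivalently, the unit map L → Prim(U(L)) of the universal-enveloping-algebra/primitive-elements adjunction is an isomorphism. -/
open TensorProduct

namespace MMoore

section generic

variable {K : Type*} [Field K] [CharZero K] {A : Type*} [Ring A] [Algebra K A]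

/-- coefficient of `t` in `(x + t y)^n` -/
def cc (x y : A) : ℕ → A
  | 0 => 0
  | n + 1 => cc x y n * x + x ^ n * y

theorem expand (x y : A) (n : ℕ) : ∃ f : ℕ → A, f 0 = x ^ n ∧ f 1 = cc x y n ∧
    ∃ N : ℕ, ∀ t : K, (x + t • y) ^ n = ∑ k ∈ Finset.range (N + 2), t ^ k • f k := by
  induction n with
  | zero =>
    refine ⟨fun k => if k = 0 then 1 else 0, by simp, by simp [cc], 0, fun t => ?_⟩
    simp [Finset.sum_range_succ]
  | succ n ih =>
    obtain ⟨f, h0, h1, N, h⟩ := ih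
    refine ⟨fun k => (if k < N + 2 then f k * x else 0) + (if k = 0 then 0 else f (k - 1) * y),
      ?_, ?_, N + 1, fun t => ?_⟩
    · simp [h0, pow_succ]
    · simp [h0, h1, cc]
    · rw [pow_succ, h]
      simp only [smul_add, Finset.sum_add_distrib, mul_add]
      congr 1
      · rw [Finset.sum_range_succ _ (N + 2), Finset.sum_mul]
        simp only [lt_irrefl, if_false, smul_zero, add_zero]
        refine Finset.sum_congr rfl fun k hk => ?_
        rw [if_pos (Finset.mem_range.1 hk), smul_mul_assoc]
      · rw [Finset.sum_range_succ' _ (N + 2), Finset.sum_mul]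
        simp [pow_succ, smul_smul, mul_comm]

theorem coeff_mem (S : Submodule K A) (f : ℕ → A) (N : ℕ)
    (h : ∀ t : K, ∑ k ∈ Finset.range N, t ^ k • f k ∈ S) (k : ℕ) (hk : k < N) : f k ∈ S := by
  by_contra hc
  obtain ⟨φ, hφ, hS⟩ := Submodule.exists_le_ker_of_notMem hc
  apply hφ
  have : (∑ k ∈ Finset.range N, Polynomial.C (φ (f k)) * Polynomial.X ^ k : Polynomial K) = 0 := by
    apply Polynomial.funext
    intro t
    have := hS (h t)
    rw [LinearMap.mem_ker, map_sum] at this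
    simp only [map_smul, smul_eq_mul] at this
    rw [Polynomial.eval_finsetSum]
    simp only [Polynomial.eval_mul, Polynomial.eval_C, Polynomial.eval_pow, Polynomial.eval_X, Polynomial.eval_zero]
    rw [← this]
    exact Finset.sum_congr rfl fun k _ => mul_comm _ _
  have h2 := congrArg (fun p => Polynomial.coeff p k) this
  simpa [Polynomial.finsetSum_coeff, Polynomial.coeff_C_mul, Polynomial.coeff_X_pow, hk] using h2

theorem cc_mem (S : Submodule K A) (x y : A) (n : ℕ) (h : ∀ t : K, (x + t • y) ^ n ∈ S) :
    cc x y n ∈ S := by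
  obtain ⟨f, -, h1, N, hf⟩ := expand (K := K) x y n
  rw [← h1]
  exact coeff_mem S f (N + 2) (fun t => hf t ▸ h t) 1 (by omega)

theorem cc_approx (x y : A) (S : ℕ → Submodule K A) (hS : ∀ n, ∀ s ∈ S n, s * x ∈ S (n + 1))
    (hb : ∀ n, x ^ n * (y * x - x * y) ∈ S (n + 1)) (n : ℕ) :
    cc x y (n + 1) - ((n : K) + 1) • (x ^ n * y) ∈ S n := by
  induction n with
  | zero => simp [cc]
  | succ n ih =>
    have h1 := hS _ _ ih
    have h2 := (S (n + 1)).smul_mem ((n : K) + 1) (hb n)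
    have := (S (n + 1)).add_mem h1 h2
    convert this using 1
    rw [cc]
    push_cast
    simp only [sub_mul, mul_sub, add_mul, smul_mul_assoc, pow_succ, add_smul, one_smul, smul_sub, mul_assoc]
    abel

variable {L : Type*} [LieRing L] [LieAlgebra K L] (j : L →ₗ[K] A)

theorem cc_mem_span (x y : L) (n : ℕ) :
    cc (j x) (j y) n ∈ Submodule.span K (Set.range fun x => j x ^ n) := by
  apply cc_mem
  intro t
  apply Submodule.subset_span
  exact ⟨x + t • y, by simp⟩

theorem pow_le_span (hj : ∀ x y, j ⁅x, y⁆ = j x * j y - j y * j x) (n : ℕ) :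
    ((1 : Submodule K A) ⊔ LinearMap.range j) ^ n ≤
      Submodule.span K {a | ∃ x, ∃ k ≤ n, a = j x ^ k} := by
  set M := (1 : Submodule K A) ⊔ LinearMap.range j with hM
  have hjM : ∀ x, j x ∈ M := fun x => Submodule.mem_sup_right ⟨x, rfl⟩
  have hMM : ∀ m n, m ≤ n → M ^ m ≤ M ^ n := fun m n h =>
    pow_le_pow_right₀ le_sup_left h
  have hW : ∀ m n, m ≤ n → Submodule.span K {a | ∃ x, ∃ k ≤ m, a = j x ^ k} ≤
      Submodule.span K {a | ∃ x, ∃ k ≤ n, a = j x ^ k} := by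
    intro m n h
    apply Submodule.span_mono
    rintro a ⟨x, k, hk, rfl⟩
    exact ⟨x, k, hk.trans h, rfl⟩
  induction n with
  | zero =>
    rw [pow_zero, Submodule.one_le]
    exact Submodule.subset_span ⟨0, 0, le_rfl, by simp⟩
  | succ n ih =>
    have key : ∀ u ∈ Submodule.span K {a | ∃ x, ∃ k ≤ n, a = j x ^ k}, ∀ m ∈ M,
        u * m ∈ Submodule.span K {a | ∃ x, ∃ k ≤ n + 1, a = j x ^ k} := by
      intro u hu m hm
      induction hu using Submodule.span_induction with
      | zero => simp
      | add a b _ _ ha hb => rw [add_mul]; exact Submodule.add_mem _ ha hb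
      | smul c a _ ha => rw [smul_mul_assoc]; exact Submodule.smul_mem _ _ ha
      | mem a ha =>
        obtain ⟨x, k, hk, rfl⟩ := ha
        obtain ⟨c, hc, z, ⟨y, rfl⟩, rfl⟩ := Submodule.mem_sup.1 hm
        rw [mul_add]
        refine Submodule.add_mem _ ?_ ?_
        · obtain ⟨c, rfl⟩ := Submodule.mem_one.1 hc
          rw [← Algebra.commutes, ← Algebra.smul_def]
          exact Submodule.smul_mem _ _ (Submodule.subset_span ⟨x, k, by omega, rfl⟩)
        · have h1 := cc_approx (K := K) (j x) (j y) (fun n => M ^ n)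
            (fun n s hs => by rw [pow_succ]; exact Submodule.mul_mem_mul hs (hjM x))
            (fun n => by
              rw [pow_succ, ← hj]
              exact Submodule.mul_mem_mul (Submodule.pow_mem_pow _ (hjM x) n) (hjM _)) k
          have h2 := hW _ _ (Nat.le_succ n) (ih (hMM k n hk h1))
          have h3 : cc (j x) (j y) (k + 1) ∈
              Submodule.span K {a | ∃ x, ∃ k ≤ n + 1, a = j x ^ k} := by
            refine Submodule.span_mono ?_ (cc_mem_span j x y (k + 1))
            rintro _ ⟨z, rfl⟩
            exact ⟨z, k + 1, by omega, rfl⟩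
          have h4 := Submodule.sub_mem _ h3 h2
          rw [sub_sub_cancel] at h4
          exact (Submodule.smul_mem_iff _ (Nat.cast_add_one_ne_zero k)).1 h4
    rw [pow_succ, Submodule.mul_le]
    exact fun u hu m hm => key u (ih hu) m hm

theorem iSup_span_eq_top (hj : ∀ x y, j ⁅x, y⁆ = j x * j y - j y * j x)
    (hgen : Algebra.adjoin K (Set.range j) = ⊤) :
    ⨆ n : ℕ, Submodule.span K (Set.range fun x => j x ^ n) = ⊤ := by
  set W := ⨆ n : ℕ, Submodule.span K (Set.range fun x => j x ^ n) with hWdef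
  have hMW : ∀ n, ((1 : Submodule K A) ⊔ LinearMap.range j) ^ n ≤ W := by
    intro n
    refine (pow_le_span j hj n).trans ?_
    rw [Submodule.span_le]
    rintro _ ⟨x, k, -, rfl⟩
    exact Submodule.mem_iSup_of_mem k (Submodule.subset_span ⟨x, rfl⟩)
  rw [eq_top_iff]
  rintro a -
  have ha : a ∈ Algebra.adjoin K (Set.range j) := hgen ▸ Algebra.mem_top
  suffices ∃ n, a ∈ ((1 : Submodule K A) ⊔ LinearMap.range j) ^ n from
    let ⟨n, h⟩ := this; hMW n h
  have hmono : ∀ m n, m ≤ n → ((1 : Submodule K A) ⊔ LinearMap.range j) ^ m ≤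
      ((1 : Submodule K A) ⊔ LinearMap.range j) ^ n := fun m n h =>
    pow_le_pow_right₀ le_sup_left h
  induction ha using Algebra.adjoin_induction with
  | mem x hx =>
    obtain ⟨x, rfl⟩ := hx
    exact ⟨1, by rw [pow_one]; exact Submodule.mem_sup_right ⟨x, rfl⟩⟩
  | algebraMap r => exact ⟨0, by rw [pow_zero]; exact Submodule.mem_one.2 ⟨r, rfl⟩⟩
  | add x y _ _ hx hy =>
    obtain ⟨m, hx⟩ := hx
    obtain ⟨n, hy⟩ := hy
    exact ⟨m + n, Submodule.add_mem _ (hmono m _ (by omega) hx) (hmono n _ (by omega) hy)⟩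
  | mul x y _ _ hx hy =>
    obtain ⟨m, hx⟩ := hx
    obtain ⟨n, hy⟩ := hy
    exact ⟨m + n, by rw [pow_add]; exact Submodule.mul_mem_mul hx hy⟩

theorem deg_one (ψ : Module.End K A) (S : ℕ → Submodule K A)
    (hS : ∀ n, S n ≤ ψ.eigenspace (2 ^ n)) (a : A) (ha : a ∈ ψ.eigenspace 2)
    (haS : a ∈ ⨆ n, S n) : a ∈ S 1 := by
  have h1 : ⨆ n, S n ≤ S 1 ⊔ ⨆ (μ : K) (_ : μ ≠ 2), ψ.eigenspace μ := by
    refine iSup_le fun n => ?_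
    by_cases hn : n = 1
    · subst hn; exact le_sup_left
    · refine le_trans (hS n) (le_trans ?_ le_sup_right)
      refine le_iSup₂_of_le (2 ^ n : K) ?_ le_rfl
      intro h
      apply hn
      have h' : (2 : ℕ) ^ n = 2 ^ 1 := by
        have : (((2 : ℕ) ^ n : ℕ) : K) = ((2 ^ 1 : ℕ) : K) := by push_cast; simpa using h
        exact_mod_cast this
      exact Nat.pow_right_injective le_rfl h'
  obtain ⟨s, hs, r, hr, rfl⟩ := Submodule.mem_sup.1 (h1 haS)
  have hs2 : s ∈ ψ.eigenspace 2 := by simpa using hS 1 hs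
  have hr2 : r ∈ ψ.eigenspace 2 := by simpa using Submodule.sub_mem _ ha hs2
  have := (Submodule.disjoint_def.1 (ψ.eigenspaces_iSupIndep 2)) r hr2 hr
  rw [this, add_zero]
  exact hs

theorem span_le_eigen (ψ : Module.End K A) (hψ : ∀ x n, ψ (j x ^ n) = (2 ^ n : K) • j x ^ n)
    (n : ℕ) : Submodule.span K (Set.range fun x => j x ^ n) ≤ ψ.eigenspace (2 ^ n) := by
  rw [Submodule.span_le]
  rintro _ ⟨x, rfl⟩
  exact Module.End.mem_eigenspace_iff.2 (hψ x n)

theorem prim_mem (hj : ∀ x y, j ⁅x, y⁆ = j x * j y - j y * j x)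
    (hgen : Algebra.adjoin K (Set.range j) = ⊤)
    (ψ : Module.End K A) (hψ : ∀ x n, ψ (j x ^ n) = (2 ^ n : K) • j x ^ n)
    (a : A) (ha : ψ a = (2 : K) • a) : a ∈ Set.range j := by
  have := deg_one ψ _ (span_le_eigen j ψ hψ) a (Module.End.mem_eigenspace_iff.2 ha)
    (by rw [iSup_span_eq_top j hj hgen]; trivial)
  have h2 : Submodule.span K (Set.range fun x => j x ^ 1) ≤ LinearMap.range j := by
    rw [Submodule.span_le]
    rintro _ ⟨x, rfl⟩
    exact ⟨x, by simp⟩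
  exact h2 this

/-- the degree `n` part of the left ideal generated by `j I` -/
def JJ (I : LieIdeal K L) (n : ℕ) : Submodule K A :=
  Submodule.span K {a | ∃ x, ∃ y ∈ I, a = cc (j x) (j y) n}

theorem JJ_one (I : LieIdeal K L) (a : A) (ha : a ∈ JJ j I 1) : ∃ y ∈ I, a = j y := by
  have : JJ j I 1 ≤ Submodule.map j (I : Submodule K L) := by
    rw [JJ, Submodule.span_le]
    rintro _ ⟨x, y, hy, rfl⟩
    exact ⟨y, hy, by simp [cc]⟩
  obtain ⟨y, hy, h⟩ := this ha
  exact ⟨y, hy, h.symm⟩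

theorem pow_mul_mem (hj : ∀ x y, j ⁅x, y⁆ = j x * j y - j y * j x) (I : LieIdeal K L)
    (x : L) (n : ℕ) : ∀ y ∈ I, j x ^ n * j y ∈ ⨆ n, JJ j I n := by
  induction n using Nat.strong_induction_on with
  | _ n ih =>
    intro y hy
    have h1 := cc_approx (K := K) (j x) (j y)
      (fun n => Submodule.span K {a | ∃ k < n, ∃ z ∈ I, a = j x ^ k * j z})
      (fun n s hs => by
        induction hs using Submodule.span_induction with
        | zero => simp
        | add a b _ _ ha hb => rw [add_mul]; exact Submodule.add_mem _ ha hb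
        | smul c a _ ha => rw [smul_mul_assoc]; exact Submodule.smul_mem _ _ ha
        | mem a ha =>
          obtain ⟨k, hk, z, hz, rfl⟩ := ha
          have : j x ^ k * j z * j x = j x ^ (k + 1) * j z + j x ^ k * j ⁅z, x⁆ := by
            rw [hj, pow_succ]; noncomm_ring
          rw [this]
          exact Submodule.add_mem _ (Submodule.subset_span ⟨k + 1, by omega, z, hz, rfl⟩)
            (Submodule.subset_span ⟨k, by omega, _, lie_mem_left K L I z x hz, rfl⟩))
      (fun n => by
        rw [← hj]
        exact Submodule.subset_span ⟨n, by omega, _, lie_mem_left K L I y x hy, rfl⟩) n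
    have h2 : Submodule.span K {a | ∃ k < n, ∃ z ∈ I, a = j x ^ k * j z} ≤ ⨆ n, JJ j I n := by
      rw [Submodule.span_le]
      rintro _ ⟨k, hk, z, hz, rfl⟩
      exact ih k hk z hz
    have h3 : cc (j x) (j y) (n + 1) ∈ ⨆ n, JJ j I n :=
      Submodule.mem_iSup_of_mem (n + 1) (Submodule.subset_span ⟨x, y, hy, rfl⟩)
    have h4 := Submodule.sub_mem _ h3 (h2 h1)
    rw [sub_sub_cancel] at h4
    exact (Submodule.smul_mem_iff _ (Nat.cast_add_one_ne_zero n)).1 h4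

theorem ideal_mem (hj : ∀ x y, j ⁅x, y⁆ = j x * j y - j y * j x)
    (hgen : Algebra.adjoin K (Set.range j) = ⊤)
    (ψ : Module.End K A) (hψ : ∀ x n, ψ (j x ^ n) = (2 ^ n : K) • j x ^ n)
    (I : LieIdeal K L) (g : L) (hg : j g ∈ Ideal.span (j '' (I : Set L))) :
    ∃ y ∈ I, j g = j y := by
  apply JJ_one j I
  refine deg_one ψ _ (fun n => ?_) (j g) ?_ ?_
  · refine le_trans ?_ (span_le_eigen j ψ hψ n)
    rw [JJ, Submodule.span_le]
    rintro _ ⟨x, y, hy, rfl⟩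
    exact cc_mem_span j x y n
  · rw [Module.End.mem_eigenspace_iff]
    simpa using hψ g 1
  · have key : ∀ u : A, ∀ y ∈ I, u * j y ∈ ⨆ n, JJ j I n := by
      intro u y hy
      have hu : u ∈ ⨆ n : ℕ, Submodule.span K (Set.range fun x => j x ^ n) := by
        rw [iSup_span_eq_top j hj hgen]; trivial
      induction hu using Submodule.iSup_induction' with
      | zero => simp
      | add a b _ _ ha hb => rw [add_mul]; exact Submodule.add_mem _ ha hb
      | mem n a ha =>
        induction ha using Submodule.span_induction with
        | zero => simp
        | add a b _ _ ha hb => rw [add_mul]; exact Submodule.add_mem _ ha hb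
        | smul c a _ ha => rw [smul_mul_assoc]; exact Submodule.smul_mem _ _ ha
        | mem a ha =>
          obtain ⟨x, rfl⟩ := ha
          exact pow_mul_mem j hj I x n y hy
    have h2 : ∀ a ∈ Ideal.span (j '' (I : Set L)), ∀ u : A, u * a ∈ ⨆ n, JJ j I n := by
      intro a ha
      induction ha using Submodule.span_induction with
      | zero => simp
      | add a b _ _ ha hb => intro u; rw [mul_add]; exact Submodule.add_mem _ (ha u) (hb u)
      | smul c a _ ha => intro u; rw [smul_eq_mul, ← mul_assoc]; exact ha _
      | mem a ha =>
        obtain ⟨y, hy, rfl⟩ := ha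
        exact fun u => key u y hy
    simpa using h2 _ hg 1

theorem ideal_twoSided (hj : ∀ x y, j ⁅x, y⁆ = j x * j y - j y * j x)
    (hgen : Algebra.adjoin K (Set.range j) = ⊤) (I : LieIdeal K L) :
    (Ideal.span (j '' (I : Set L))).IsTwoSided := by
  refine ⟨fun {a} b ha => ?_⟩
  have hb : b ∈ Algebra.adjoin K (Set.range j) := hgen ▸ Algebra.mem_top
  induction hb using Algebra.adjoin_induction generalizing a with
  | mem x hx =>
    obtain ⟨x, rfl⟩ := hx
    induction ha using Submodule.span_induction with
    | zero => simp
    | add a b _ _ ha hb => rw [add_mul]; exact Submodule.add_mem _ ha hb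
    | smul c a _ ha => rw [smul_mul_assoc]; exact Submodule.smul_mem _ _ ha
    | mem a ha =>
      obtain ⟨y, hy, rfl⟩ := ha
      have : j y * j x = j x * j y + j ⁅y, x⁆ := by rw [hj]; abel
      rw [this]
      exact Ideal.add_mem _ (Ideal.mul_mem_left _ _ (Ideal.subset_span ⟨y, hy, rfl⟩))
        (Ideal.subset_span ⟨_, lie_mem_left K L I y x hy, rfl⟩)
  | algebraMap r => rw [← Algebra.commutes]; exact Ideal.mul_mem_left _ _ ha
  | add x y _ _ hx hy => rw [mul_add]; exact Ideal.add_mem _ (hx ha) (hy ha)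
  | mul x y _ _ hx hy => rw [← mul_assoc]; exact hy (hx ha)

end generic

section env

attribute [local instance] LieRing.ofAssociativeRing

local notation "UU" => UniversalEnvelopingAlgebra

open UniversalEnvelopingAlgebra

variable {K : Type*} [Field K] {L : Type*} [LieRing L] [LieAlgebra K L]

/-- `ι` as a linear map -/
noncomputable def jj (K : Type*) [Field K] (L : Type*) [LieRing L] [LieAlgebra K L] :
    L →ₗ[K] UU K L := (ι K : L →ₗ⁅K⁆ UU K L)

theorem jj_apply (x : L) : jj K L x = ι K x := rfl

theorem jj_lie (x y : L) : jj K L ⁅x, y⁆ = jj K L x * jj K L y - jj K L y * jj K L x := by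
  simp only [jj_apply, LieHom.map_lie, LieRing.of_associative_ring_bracket]

theorem jj_gen : Algebra.adjoin K (Set.range (jj K L)) = ⊤ := by
  have hs : Function.Surjective (mkAlgHom K L) := Quotient.mk_surjective
  have h1 : Set.range (jj K L) = mkAlgHom K L '' Set.range (TensorAlgebra.ι K) := by
    rw [← Set.range_comp]; rfl
  rw [h1, ← AlgHom.map_adjoin, TensorAlgebra.adjoin_range_ι, Algebra.map_top,
    (AlgHom.range_eq_top _).2 hs]

theorem psi_pow (Δ : UU K L →ₐ[K] UU K L ⊗[K] UU K L)
    (hΔ : ∀ x : L, Δ (ι K x) = ι K x ⊗ₜ[K] 1 + 1 ⊗ₜ[K] ι K x) (x : L) (n : ℕ) :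
    (LinearMap.mul' K (UU K L) ∘ₗ Δ.toLinearMap) (jj K L x ^ n) = (2 ^ n : K) • jj K L x ^ n := by
  have hc : Commute (ι K x ⊗ₜ[K] (1 : UU K L)) ((1 : UU K L) ⊗ₜ[K] ι K x) := by
    simp [Commute, SemiconjBy]
  simp only [LinearMap.comp_apply, AlgHom.toLinearMap_apply, map_pow, jj_apply, hΔ]
  rw [hc.add_pow, map_sum]
  have : ∀ m ∈ Finset.range (n + 1), LinearMap.mul' K (UU K L)
      ((ι K x ⊗ₜ[K] (1 : UU K L)) ^ m * ((1 : UU K L) ⊗ₜ[K] ι K x) ^ (n - m) * (n.choose m : ℕ)) =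
      (n.choose m : K) • ι K x ^ n := by
    intro m hm
    have hm : m + (n - m) = n := by have := Finset.mem_range.1 hm; omega
    rw [← Nat.cast_comm, ← nsmul_eq_mul, map_nsmul]
    simp only [Algebra.TensorProduct.tmul_pow, one_pow, Algebra.TensorProduct.tmul_mul_tmul,
      one_mul, mul_one, LinearMap.mul'_apply]
    rw [← pow_add, hm, Nat.cast_smul_eq_nsmul]
  rw [Finset.sum_congr rfl this, ← Finset.sum_smul, ← Nat.cast_sum, Nat.sum_range_choose]
  push_cast
  rfl

/-- the standard comultiplication -/
noncomputable def DD (K : Type*) [Field K] (L : Type*) [LieRing L] [LieAlgebra K L] :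
    UU K L →ₐ[K] UU K L ⊗[K] UU K L :=
  lift K
    { toFun := fun x => ι K x ⊗ₜ[K] 1 + 1 ⊗ₜ[K] ι K x
      map_add' := fun x y => by simp only [map_add, add_tmul, tmul_add]; abel
      map_smul' := fun c x => by simp [smul_tmul', tmul_smul]
      map_lie' := fun {x y} => by
        simp only [LieHom.map_lie, LieRing.of_associative_ring_bracket, add_mul, mul_add,
          Algebra.TensorProduct.tmul_mul_tmul, one_mul, mul_one, sub_tmul, tmul_sub]
        abel }

theorem DD_ι (x : L) : DD K L (ι K x) = ι K x ⊗ₜ[K] 1 + 1 ⊗ₜ[K] ι K x := by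
  rw [DD, lift_ι_apply]; rfl

theorem inj_of_quot [CharZero K] {G : Type*} [LieRing G] [LieAlgebra K G] (π : G →ₗ⁅K⁆ L)
    (hπ : Function.Surjective π) (hG : Function.Injective (ι K : G →ₗ⁅K⁆ UU K G)) :
    Function.Injective (ι K : L →ₗ⁅K⁆ UU K L) := by
  rw [injective_iff_map_eq_zero]
  intro x hx
  obtain ⟨σ, hσ⟩ := (π : G →ₗ[K] L).exists_rightInverse_of_surjective
    (LinearMap.range_eq_top.2 hπ)
  have hσ' : ∀ x, π (σ x) = x := fun x => LinearMap.congr_fun hσ x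
  have := ideal_twoSided (jj K G) jj_lie jj_gen π.ker
  set Q := Ideal.span (jj K G '' (π.ker : Set G)) with hQ
  have hmk : ∀ g, π g = 0 → Ideal.Quotient.mkₐ K Q (jj K G g) = 0 := fun g hg =>
    Ideal.Quotient.eq_zero_iff_mem.2 (Ideal.subset_span ⟨g, by simpa using hg, rfl⟩)
  let f : L →ₗ⁅K⁆ (UU K G ⧸ Q) :=
    { (Ideal.Quotient.mkₐ K Q).toLinearMap ∘ₗ jj K G ∘ₗ σ with
      map_lie' := fun {x y} => by
        have := hmk (σ ⁅x, y⁆ - ⁅σ x, σ y⁆) (by simp [hσ'])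
        rw [map_sub, map_sub, sub_eq_zero, jj_lie, map_sub, map_mul, map_mul] at this
        exact this }
  have h1 : lift K f (ι K x) = f x := lift_ι_apply K f x
  rw [hx, map_zero] at h1
  have h2 : jj K G (σ x) ∈ Q := Ideal.Quotient.eq_zero_iff_mem.1 h1.symm
  obtain ⟨y, hy, h3⟩ := ideal_mem (jj K G) jj_lie jj_gen _ (psi_pow (DD K G) DD_ι) π.ker _ h2
  have h4 := hG h3
  rw [← hσ' x, h4]
  simpa using hy

open Polynomial in
/-- evaluation of `L`-valued polynomials -/
noncomputable def ev (a : K) : K[X] ⊗[K] L →ₗ⁅K⁆ L :=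
  { (TensorProduct.lid K L).toLinearMap ∘ₗ (aeval a : K[X] →ₐ[K] K).toLinearMap.rTensor L with
    map_lie' := fun {x y} => by
      simp only [AddHom.toFun_eq_coe, LinearMap.coe_toAddHom]
      induction x using TensorProduct.induction_on with
      | zero => simp
      | add x y hx hy => simp only [add_lie, map_add, hx, hy]
      | tmul p u =>
        induction y using TensorProduct.induction_on with
        | zero => simp
        | add x y hx hy => simp only [lie_add, map_add, hx, hy]
        | tmul q v => simp [LieAlgebra.ExtendScalars.bracket_tmul, smul_smul, mul_comm] }

open Polynomial in
theorem ev_tmul (a : K) (p : K[X]) (x : L) : ev a (p ⊗ₜ[K] x) = p.eval a • x := by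
  change TensorProduct.lid K L ((aeval a : K[X] →ₐ[K] K).toLinearMap.rTensor L (p ⊗ₜ[K] x)) = _
  simp [aeval_def]

open Polynomial in
/-- derivative of `L`-valued polynomials -/
noncomputable def der (K : Type*) [Field K] (L : Type*) [LieRing L] [LieAlgebra K L] :
    LieDerivation K (K[X] ⊗[K] L) (K[X] ⊗[K] L) where
  toLinearMap := (derivative (R := K)).rTensor L
  leibniz' x y := by
    rw [← lie_skew y, sub_neg_eq_add]
    induction x using TensorProduct.induction_on with
    | zero => simp
    | add x y hx hy => simp only [add_lie, lie_add, map_add, hx, hy]; abel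
    | tmul p u =>
      induction y using TensorProduct.induction_on with
      | zero => simp
      | add x y hx hy => simp only [lie_add, add_lie, map_add, hx, hy]; abel
      | tmul q v => simp [LieAlgebra.ExtendScalars.bracket_tmul, add_tmul]; abel

open Polynomial in
theorem der_inj [CharZero K] (f : K[X] ⊗[K] L) (h : der K L f = 0) (h0 : ev (0 : K) f = 0) : f = 0 := by
  let Int : K[X] →ₗ[K] K[X] := Polynomial.lsum fun n => (monomial (n + 1)) ∘ₗ
    LinearMap.lsmul K K ((n : K) + 1)⁻¹
  have hI : ∀ p : K[X], Int (derivative p) = p - C (p.eval 0) := by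
    intro p
    induction p using Polynomial.induction_on' with
    | add p q hp hq => simp only [map_add, hp, hq, eval_add]; abel
    | monomial n a =>
      rcases n with _ | n
      · simp [Int]
      · have : (n : K) + 1 ≠ 0 := Nat.cast_add_one_ne_zero n
        simp [Int, derivative_monomial, Polynomial.lsum_apply, Polynomial.sum_monomial_index]
        field_simp
  have key : ∀ f : K[X] ⊗[K] L, Int.rTensor L (der K L f) = f - 1 ⊗ₜ[K] ev (0 : K) f := by
    intro f
    induction f using TensorProduct.induction_on with
    | zero => simp
    | add x y hx hy => simp only [map_add, hx, hy, tmul_add]; abel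
    | tmul p u =>
      change Int.rTensor L ((derivative (R := K)).rTensor L (p ⊗ₜ[K] u)) = _
      rw [ev_tmul, LinearMap.rTensor_tmul, LinearMap.rTensor_tmul, hI, sub_tmul,
        tmul_smul, smul_tmul', smul_eq_C_mul, mul_one]
  have := key f
  rw [h, h0] at this
  simpa using this.symm

/-- adjoint representation of the extension of a Lie algebra by a derivation -/
noncomputable def rho {H : Type*} [LieRing H] [LieAlgebra K H] (D : LieDerivation K H H) :
    H →ₗ⁅K⁆ Module.End K (H × K) where
  toFun f := LinearMap.inl K _ _ ∘ₗ
    (LinearMap.coprod (LieAlgebra.ad K H f) (LinearMap.toSpanSingleton K _ (D f)))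
  map_add' f g := by
    ext <;> simp
  map_smul' c f := by
    ext <;> simp
  map_lie' {f g} := by
    rw [LieRing.of_associative_ring_bracket]
    apply LinearMap.ext
    rintro ⟨h, s⟩
    simp [smul_sub]
    abel

theorem rho_apply {H : Type*} [LieRing H] [LieAlgebra K H] (D : LieDerivation K H H) (f : H) :
    (rho D f (0, 1)).1 = D f := by
  simp [rho]

open Polynomial in
theorem ι_inj [CharZero K] : Function.Injective (ι K : L →ₗ⁅K⁆ UU K L) := by
  let e0 : K[X] ⊗[K] L →ₗ⁅K⁆ L := ev 0
  let π : ↥e0.ker →ₗ⁅K⁆ L := (ev 1).comp (e0.ker.incl)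
  refine inj_of_quot π ?_ ?_
  · intro x
    exact ⟨⟨X ⊗ₜ[K] x, by simp [e0, ev_tmul]⟩, by simp [π, ev_tmul]⟩
  · rw [injective_iff_map_eq_zero]
    intro g hg
    let r := (rho (der K L)).comp (e0.ker.incl)
    have h1 : lift K r (ι K g) = r g := lift_ι_apply K r g
    rw [hg, map_zero] at h1
    have h2 := congrArg Prod.fst (LinearMap.congr_fun h1.symm (0, 1))
    apply Subtype.ext
    refine der_inj _ ?_ ?_
    · exact (rho_apply (der K L) (g : K[X] ⊗[K] L)).symm.trans h2
    · exact LieHom.mem_ker.1 g.2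

end env

end MMoore

/-- **Milnor–Moore/Friedrichs theorem (unit isomorphism).**
Let `K` be a field of characteristic zero and `L` a Lie algebra over `K`.  Equip the
universal enveloping algebra `U(L)` with its standard bialgebra structure: this is encoded
by a hypothesized coalgebra structure whose comultiplication and counit are algebra
homomorphisms (the hypotheses `hcounit_one`, `hcounit_mul`, `hcomul_one`, `hcomul_mul`,
which together with the coalgebra structure constitute a bialgebra structure) and which
satisfies `comul (ι x) = ι x ⊗ 1 + 1 ⊗ ι x` and `counit (ι x) = 0`; these conditions
determine the bialgebra structure uniquely.  Then the canonical map `ι : L → U(L)` is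
injective and its range is exactly the set of primitive elements of `U(L)`;
equivalently, the unit map `L → Prim(U(L))` of the universal-enveloping-algebra /
primitive-elements adjunction is an isomorphism. -/
theorem milnor_moore_unit_iso
    (K : Type*) [Field K] [CharZero K]
    (L : Type*) [LieRing L] [LieAlgebra K L]
    [Coalgebra K (UniversalEnvelopingAlgebra K L)]
    (hcounit_one : Coalgebra.counit (R := K) (1 : UniversalEnvelopingAlgebra K L) = 1)
    (hcounit_mul : ∀ a b : UniversalEnvelopingAlgebra K L,
      Coalgebra.counit (R := K) (a * b) =
        Coalgebra.counit (R := K) a * Coalgebra.counit (R := K) b)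
    (hcomul_one : Coalgebra.comul (R := K) (1 : UniversalEnvelopingAlgebra K L) = 1)
    (hcomul_mul : ∀ a b : UniversalEnvelopingAlgebra K L,
      Coalgebra.comul (R := K) (a * b) =
        Coalgebra.comul (R := K) a * Coalgebra.comul (R := K) b)
    (hcomul : ∀ x : L,
      Coalgebra.comul (R := K) (UniversalEnvelopingAlgebra.ι K x) =
        UniversalEnvelopingAlgebra.ι K x ⊗ₜ[K] 1 + 1 ⊗ₜ[K] UniversalEnvelopingAlgebra.ι K x)
    (hcounit : ∀ x : L,
      Coalgebra.counit (R := K) (UniversalEnvelopingAlgebra.ι K x) = 0) :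
    Function.Injective (UniversalEnvelopingAlgebra.ι K (L := L)) ∧
      Set.range (UniversalEnvelopingAlgebra.ι K (L := L)) =
        {a : UniversalEnvelopingAlgebra K L |
          Coalgebra.comul (R := K) a = a ⊗ₜ[K] 1 + 1 ⊗ₜ[K] a} := by
  refine ⟨MMoore.ι_inj, ?_⟩
  let Δ : UniversalEnvelopingAlgebra K L →ₐ[K]
      UniversalEnvelopingAlgebra K L ⊗[K] UniversalEnvelopingAlgebra K L :=
    AlgHom.ofLinearMap (Coalgebra.comul (R := K)) hcomul_one hcomul_mul
  ext a
  constructor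
  · rintro ⟨x, rfl⟩
    exact hcomul x
  · intro ha
    have ha' : Coalgebra.comul (R := K) a = a ⊗ₜ[K] 1 + 1 ⊗ₜ[K] a := ha
    have := MMoore.prim_mem (MMoore.jj K L) MMoore.jj_lie MMoore.jj_gen _
      (MMoore.psi_pow Δ hcomul) a (by
        change LinearMap.mul' K _ (Coalgebra.comul (R := K) a) = _
        rw [ha', map_add, LinearMap.mul'_apply, LinearMap.mul'_apply, one_mul, mul_one, two_smul])
    exact this
end

section
/- Milnor–Moore theorem, full faithfulness on morphisms (Theorem "Mil"): Let K be a field of characteristic zero and let L₁, L₂ be Lie algebras over K, with each universal enveloping algebra U(L₁), U(L₂) carrying its standard bialgebra structure. Then for every K-algebra homomorphism φ : U(L₁) → U(L₂) that commutes with the comultiplications and counits (i.e., every bialgebra homomorphism), there exists a unique Lie algebra homomorphism f : L₁ → L₂ such that φ ∘ ι = ι ∘ f. -/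
open TensorProduct

noncomputable section PBW
set_option linter.unusedSectionVars false
attribute [local instance 100] LieRing.ofAssociativeRing
namespace MM
variable {K L I : Type*} [Field K] [LieRing L] [LieAlgebra K L] [LinearOrder I] (b : Module.Basis I K L)

abbrev S (K I : Type*) [Field K] := Multiset I →₀ K

/-- bilinear extension -/
def ext (f : I → Multiset I → S K I) : L →ₗ[K] S K I →ₗ[K] S K I :=
  b.constr K fun i => Finsupp.lsum K fun M => LinearMap.toSpanSingleton K _ (f i M)

lemma ext_apply (f : I → Multiset I → S K I) (i : I) (M : Multiset I) :
    ext b f (b i) (Finsupp.single M 1) = f i M := by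
  simp [ext]

open Classical in
def f (b : Module.Basis I K L) : ℕ → I → Multiset I → S K I
  | 0, i, M => Finsupp.single (i ::ₘ M) 1
  | n + 1, i, M =>
      if h : M.card ≤ n then f b n i M
      else if ∀ k ∈ M, i ≤ k then Finsupp.single (i ::ₘ M) 1
      else
        let j := (M.toFinset.min' (by
          rw [Multiset.toFinset_nonempty]; rintro rfl; simp at h))
        let N := M.erase j
        Finsupp.single (i ::ₘ M) 1
          + ext b (f b n) (b j) (ext b (f b n) (b i) (Finsupp.single N 1) - Finsupp.single (i ::ₘ N) 1)
          + ext b (f b n) ⁅b i, b j⁆ (Finsupp.single N 1)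

lemma f_stable (n : ℕ) (i : I) (M : Multiset I) (h : M.card ≤ n) : f b n i M = f b M.card i M := by
  induction n with
  | zero => simp at h; subst h; rfl
  | succ n ih =>
    by_cases h' : M.card ≤ n
    · rw [f, dif_pos h', ih h']
    · rw [show M.card = n + 1 by omega]

def R (b : Module.Basis I K L) : L →ₗ[K] S K I →ₗ[K] S K I := ext b fun i M => f b M.card i M

def D (K I : Type*) [Field K] (n : ℕ) : Submodule K (S K I) :=
  Submodule.span K {s | ∃ M : Multiset I, M.card ≤ n ∧ s = Finsupp.single M 1}

lemma D_mono {m n : ℕ} (h : m ≤ n) : D K I m ≤ D K I n :=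
  Submodule.span_mono fun _ ⟨M, hM, e⟩ => ⟨M, hM.trans h, e⟩

lemma single_mem {n : ℕ} (M : Multiset I) (h : M.card ≤ n) : (Finsupp.single M 1 : S K I) ∈ D K I n :=
  Submodule.subset_span ⟨M, h, rfl⟩

lemma ext_congr (g h : I → Multiset I → S K I) (n : ℕ) (e : ∀ i M, M.card ≤ n → g i M = h i M)
    (x : L) (s : S K I) (hs : s ∈ D K I n) : ext b g x s = ext b h x s := by
  have : ∀ i, ext b g (b i) s = ext b h (b i) s := by
    intro i
    induction hs using Submodule.span_induction with
    | mem s hs => obtain ⟨M, hM, rfl⟩ := hs; simp [ext_apply, e i M hM]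
    | zero => simp
    | add x y _ _ hx hy => simp [hx, hy]
    | smul c x _ hx => simp [hx]
  have h2 : (ext b g).flip s = (ext b h).flip s := b.ext this
  exact LinearMap.congr_fun h2 x

lemma ext_f (n : ℕ) (x : L) (s : S K I) (hs : s ∈ D K I n) : ext b (f b n) x s = R b x s :=
  ext_congr b _ _ n (fun i M h => f_stable b n i M h) x s hs

lemma R_min (i : I) (M : Multiset I) (h : ∀ k ∈ M, i ≤ k) :
    R b (b i) (Finsupp.single M 1) = Finsupp.single (i ::ₘ M) 1 := by
  rw [R, ext_apply]
  rcases hc : M.card with _ | n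
  · rfl
  · rw [f, dif_neg (by omega), if_pos h]

lemma ext_mem (g : I → Multiset I → S K I) (n m : ℕ) (e : ∀ i M, M.card ≤ n → g i M ∈ D K I m)
    (x : L) (s : S K I) (hs : s ∈ D K I n) : ext b g x s ∈ D K I m := by
  have key : ∀ i, ext b g (b i) s ∈ D K I m := by
    intro i
    induction hs using Submodule.span_induction with
    | mem s hs => obtain ⟨M, hM, rfl⟩ := hs; simpa [ext_apply] using e i M hM
    | zero => simp
    | add x y _ _ hx hy => simpa using add_mem hx hy
    | smul c x _ hx => simpa using Submodule.smul_mem _ c hx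
  have hx := b.mem_span x
  induction hx using Submodule.span_induction with
  | mem x hx => obtain ⟨i, rfl⟩ := hx; exact key i
  | zero => simp
  | add x y _ _ hx hy => simpa using add_mem hx hy
  | smul c x _ hx => simpa using Submodule.smul_mem _ c hx

open Classical in
lemma exists_min (i : I) (M : Multiset I) (h : ¬ ∀ k ∈ M, i ≤ k) :
    ∃ j N, M = j ::ₘ N ∧ j < i ∧ (∀ k ∈ N, j ≤ k) ∧ 
     ((hn : M.toFinset.Nonempty) → M.toFinset.min' hn = j ∧ M.erase j = N) := by
  push Not at h
  obtain ⟨k, hk, hki⟩ := h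
  have hn : M.toFinset.Nonempty := ⟨k, by simpa⟩
  have hm := M.toFinset.min'_mem hn
  refine ⟨M.toFinset.min' hn, M.erase (M.toFinset.min' hn), ?_, ?_, ?_, ?_⟩
  · rw [Multiset.cons_erase]; simpa using hm
  · exact (Finset.min'_le _ _ (by simpa)).trans_lt hki
  · intro l hl; exact Finset.min'_le _ _ (by simpa using Multiset.mem_of_mem_erase hl)
  · intro _; exact ⟨rfl, rfl⟩

lemma f_lower (n : ℕ) : ∀ (i : I) (M : Multiset I), M.card ≤ n →
    f b n i M - Finsupp.single (i ::ₘ M) 1 ∈ D K I M.card := by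
  induction n with
  | zero => intro i M h; simp [f]
  | succ n ih =>
    intro i M h
    have up : ∀ i M, M.card ≤ n → f b n i M ∈ D K I (n+1) := by
      intro i M h
      have := add_mem (D_mono (by omega : M.card ≤ n + 1) (ih i M h))
        (single_mem (n := n + 1) (K := K) (i ::ₘ M) (by simpa using h))
      simpa using this
    by_cases h' : M.card ≤ n
    · rw [f, dif_pos h']; exact ih i M h'
    · rw [f, dif_neg h']
      split_ifs with h2
      · simp
      · obtain ⟨j, N, rfl, hji, hN, hmin⟩ := exists_min i M h2
        obtain ⟨e1, e2⟩ := hmin (by simp)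
        have hc : N.card = n := by simp at h h'; omega
        simp only [e1, e2, Multiset.card_cons, hc]
        rw [add_assoc, add_sub_cancel_left]
        refine add_mem (ext_mem b _ n (n+1) up _ _ ?_) (ext_mem b _ n (n+1) up _ _ ?_)
        · rw [ext_apply, ← hc]; subst hc; exact ih i N le_rfl
        · exact single_mem _ hc.le

lemma R_lower (i : I) (M : Multiset I) :
    R b (b i) (Finsupp.single M 1) - Finsupp.single (i ::ₘ M) 1 ∈ D K I M.card := by
  rw [R, ext_apply]; exact f_lower b _ i M le_rfl

lemma R_step (i j : I) (N : Multiset I) (hji : j < i) (hN : ∀ k ∈ N, j ≤ k) :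
    R b (b i) (Finsupp.single (j ::ₘ N) 1) =
      R b (b j) (R b (b i) (Finsupp.single N 1)) + R b ⁅b i, b j⁆ (Finsupp.single N 1) := by
  have h2 : ¬ ∀ k ∈ j ::ₘ N, i ≤ k := by
    intro h; exact absurd (h j (by simp)) (not_le.2 hji)
  obtain ⟨j', N', e, hji', hN', hmin⟩ := exists_min i _ h2
  have hj : j' = j := by
    apply le_antisymm
    · have : j ∈ j' ::ₘ N' := by rw [← e]; simp
      rcases Multiset.mem_cons.1 this with h | h
      · exact h.ge
      · exact hN' _ h
    · have : j' ∈ j ::ₘ N := by rw [e]; simp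
      rcases Multiset.mem_cons.1 this with h | h
      · exact h.ge
      · exact hN _ h
  subst hj
  obtain rfl : N = N' := by simpa using e
  obtain ⟨e1, e2⟩ := hmin (by simp)
  conv_lhs => rw [R, ext_apply]
  rw [Multiset.card_cons, f, dif_neg (by simp), if_neg h2]
  simp only [e1, e2]
  have hs : (Finsupp.single N 1 : S K I) ∈ D K I N.card := single_mem _ le_rfl
  rw [ext_f b _ _ _ hs, ext_f b _ _ _ hs, ext_f b _ _ _ (R_lower b i N), map_sub,
    R_min b j' (i ::ₘ N) (by simpa using ⟨hji.le, hN⟩), Multiset.cons_swap]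
  abel

lemma R_comm_mem (n : ℕ) (x y : L) 
    (H : ∀ M : Multiset I, M.card ≤ n → R b x (R b y (Finsupp.single M 1)) = 
      R b y (R b x (Finsupp.single M 1)) + R b ⁅x, y⁆ (Finsupp.single M 1)) (s : S K I) (hs : s ∈ D K I n) :
    R b x (R b y s) = R b y (R b x s) + R b ⁅x, y⁆ s := by
  induction hs using Submodule.span_induction with
  | mem s hs => obtain ⟨M, hM, rfl⟩ := hs; exact H M hM
  | zero => simp
  | add x y _ _ hx hy => simp only [map_add, hx, hy]; abel
  | smul c x _ hx => simp [hx]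

lemma R_bilin (s : S K I) 
    (H : ∀ i j, j < i → R b (b i) (R b (b j) s) = R b (b j) (R b (b i) s) + R b ⁅b i, b j⁆ s) (x y : L) :
    R b x (R b y s) = R b y (R b x s) + R b ⁅x, y⁆ s := by
  have H' : ∀ i j, R b (b i) (R b (b j) s) = R b (b j) (R b (b i) s) + R b ⁅b i, b j⁆ s := by
    intro i j
    rcases lt_trichotomy i j with h | rfl | h
    · rw [H j i h, ← lie_skew (b i) (b j)]; simp only [map_neg, LinearMap.neg_apply]; abel
    · simp
    · exact H i j h
  have hx := b.mem_span x
  induction hx using Submodule.span_induction with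
  | zero => simp
  | add x y _ _ hx hy => simp only [map_add, add_lie, LinearMap.add_apply, hx, hy]; abel
  | smul c x _ hx => simp [hx]
  | mem x hx =>
    obtain ⟨i, rfl⟩ := hx
    have hy := b.mem_span y
    induction hy using Submodule.span_induction with
    | zero => simp
    | add x y _ _ hx hy => simp only [map_add, lie_add, LinearMap.add_apply, hx, hy]; abel
    | smul c x _ hx => simp [hx]
    | mem x hx => obtain ⟨j, rfl⟩ := hx; exact H' i j

lemma R_comm_aux (n : ℕ) : ∀ (M : Multiset I), M.card ≤ n → ∀ x y : L,
    R b x (R b y (Finsupp.single M 1)) = 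
      R b y (R b x (Finsupp.single M 1)) + R b ⁅x, y⁆ (Finsupp.single M 1) := by
  induction n with
  | zero =>
    intro M hM
    obtain rfl : M = 0 := by simpa using hM
    refine R_bilin b _ fun i j hji => ?_
    rw [R_min b j 0 (by simp), R_step b i j 0 hji (by simp)]
  | succ n ih =>
    intro M hM
    refine R_bilin b _ fun i j hji => ?_
    by_cases h : ∀ k ∈ M, j ≤ k
    · rw [R_min b j M h, R_step b i j M hji h]
    obtain ⟨k, N, rfl, hkj, hN, -⟩ := exists_min j M h
    have hc : N.card ≤ n := by simpa using hM
    have hs : (Finsupp.single N 1 : S K I) ∈ D K I n := single_mem _ hc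
    have IH : ∀ s ∈ D K I n, ∀ x y : L, R b x (R b y s) = R b y (R b x s) + R b ⁅x, y⁆ s :=
      fun s hs x y => R_comm_mem b n x y (fun M hM => ih M hM x y) s hs
    have key : ∀ i j, k < i → k < j →
        R b (b i) (R b (b k) (R b (b j) (Finsupp.single N 1))) =
          R b (b k) (R b (b i) (R b (b j) (Finsupp.single N 1))) +
          R b ⁅b i, b k⁆ (R b (b j) (Finsupp.single N 1)) := by
      intro i j hi hj
      have hN' : ∀ l ∈ j ::ₘ N, k ≤ l := by simpa using ⟨hj.le, hN⟩
      have h1 := IH _ (D_mono hc (R_lower b j N)) (b i) (b k)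
      have h2 : R b (b i) (R b (b k) (Finsupp.single (j ::ₘ N) 1)) = 
          R b (b k) (R b (b i) (Finsupp.single (j ::ₘ N) 1)) + R b ⁅b i, b k⁆ (Finsupp.single (j ::ₘ N) 1) := by
        rw [R_min b k _ hN', R_step b i k _ hi hN']
      generalize R b (b j) (Finsupp.single N 1) = u at *
      generalize (Finsupp.single (j ::ₘ N) 1 : S K I) = v at *
      simp only [map_sub] at h1
      rw [h2, sub_eq_iff_eq_add] at h1
      rw [h1]; abel
    rw [← R_min b k N hN]
    generalize (Finsupp.single N 1 : S K I) = s at *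
    have hki := hkj.trans hji
    rw [IH s hs (b j) (b k), IH s hs (b i) (b k), map_add, map_add, key i j hki hkj, key j i hkj hki,
      IH s hs (b i) ⁅b j, b k⁆, IH s hs (b j) ⁅b i, b k⁆, IH s hs ⁅b i, b j⁆ (b k), IH s hs (b i) (b j),
      lie_lie (b i) (b j) (b k)]
    simp only [map_add, map_sub, LinearMap.sub_apply]
    abel

lemma R_comm (x y : L) (s : S K I) : R b x (R b y s) = R b y (R b x s) + R b ⁅x, y⁆ s := by
  induction s using Finsupp.induction_linear with
  | zero => simp
  | add f g hf hg => simp only [map_add, hf, hg]; abel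
  | single M c => 
    have := R_comm_aux b M.card M le_rfl x y
    rw [show (Finsupp.single M c : S K I) = c • Finsupp.single M 1 by simp]
    simp only [map_smul, ← smul_add, this]

lemma R_zero (x : L) (h : R b x (Finsupp.single 0 1) = 0) : x = 0 := by
  have e : (R b).flip (Finsupp.single 0 1) =
      (Finsupp.lmapDomain K K (fun i : I => ({i} : Multiset I))) ∘ₗ b.repr.toLinearMap := by
    refine b.ext fun i => ?_
    have := R_min b i 0 (by simp)
    simpa using this
  have h' : (R b).flip (Finsupp.single 0 1) x = 0 := h
  rw [e] at h'
  have := Finsupp.mapDomain_injective (fun _ _ h => Multiset.singleton_inj.1 h) (a₁ := b.repr x) (a₂ := 0) (M := K)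
    (by simpa using h')
  simpa using this

end MM

theorem MM.ι_injective (K L : Type*) [Field K] [LieRing L] [LieAlgebra K L] :
    Function.Injective (UniversalEnvelopingAlgebra.ι K : L → UniversalEnvelopingAlgebra K L) := by
  classical
  let b := Module.Basis.ofVectorSpace K L
  obtain ⟨inst, -⟩ := exists_wellFoundedLT (Module.Basis.ofVectorSpaceIndex K L)
  let ρ : L →ₗ⁅K⁆ Module.End K (S K (Module.Basis.ofVectorSpaceIndex K L)) :=
    { R b with
      map_lie' := by
        intro x y
        refine LinearMap.ext fun s => ?_
        have := R_comm b x y s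
        rw [Ring.lie_def]
        simp only [LinearMap.sub_apply, Module.End.mul_apply, AddHom.toFun_eq_coe, LinearMap.coe_toAddHom]
        rw [this]; abel }
  refine (injective_iff_map_eq_zero _).2 fun x hx => R_zero b x ?_
  have := UniversalEnvelopingAlgebra.lift_ι_apply K ρ x
  rw [hx, map_zero] at this
  change ρ x _ = 0
  rw [← this]; rfl
end PBW


noncomputable section Prim
set_option linter.unusedSectionVars false
attribute [local instance 100] LieRing.ofAssociativeRing
namespace MM
open UniversalEnvelopingAlgebra
variable (K L : Type*) [Field K] [LieRing L] [LieAlgebra K L]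
local notation "U" => UniversalEnvelopingAlgebra K L

lemma ι_lie (x y : L) : (ι K ⁅x, y⁆ : U) = ι K x * ι K y - ι K y * ι K x := by
  rw [LieHom.map_lie, Ring.lie_def]

def G : Submodule K U := 1 ⊔ LinearMap.range (ι K : L →ₗ⁅K⁆ U).toLinearMap

lemma one_le_G : (1 : Submodule K U) ≤ G K L := le_sup_left

lemma ι_mem_G (x : L) : ι K x ∈ G K L := 
  (le_sup_right : _ ≤ G K L) ⟨x, rfl⟩

lemma mem_G {m : U} (h : m ∈ G K L) : ∃ (c : K) (x : L), m = algebraMap K U c + ι K x := by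
  obtain ⟨a, ha, c, ⟨x, rfl⟩, rfl⟩ := Submodule.mem_sup.1 h
  obtain ⟨c, rfl⟩ := Submodule.mem_one.1 ha
  exact ⟨c, x, rfl⟩

lemma G_mono {m n : ℕ} (h : m ≤ n) : G K L ^ m ≤ G K L ^ n :=
  pow_le_pow_right₀ (one_le_G K L) h

lemma ι_mul_mem (x : L) {n : ℕ} {u : U} (hu : u ∈ G K L ^ n) : ι K x * u ∈ G K L ^ (n + 1) := by
  rw [pow_succ']; exact Submodule.mul_mem_mul (ι_mem_G K L x) hu

lemma exhaust (u : U) : ∃ n, u ∈ G K L ^ n := by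
  have hs : Function.Surjective (mkAlgHom K L) := RingCon.mkₐ_surjective _
  obtain ⟨t, rfl⟩ := hs u
  induction t using TensorAlgebra.induction with
  | algebraMap r => 
    refine ⟨0, ?_⟩
    rw [pow_zero, AlgHom.commutes]; exact Submodule.mem_one.2 ⟨r, rfl⟩
  | ι x => exact ⟨1, by rw [pow_one]; exact ι_mem_G K L x⟩
  | mul a b ha hb =>
    obtain ⟨m, hm⟩ := ha
    obtain ⟨n, hn⟩ := hb
    exact ⟨m + n, by rw [map_mul, pow_add]; exact Submodule.mul_mem_mul hm hn⟩
  | add a b ha hb =>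
    obtain ⟨m, hm⟩ := ha
    obtain ⟨n, hn⟩ := hb
    exact ⟨m + n, by 
      rw [map_add]; exact add_mem (G_mono K L (by omega) hm) (G_mono K L (by omega) hn)⟩

lemma comm_mem (y : L) (n : ℕ) : ∀ u ∈ G K L ^ n, u * ι K y - ι K y * u ∈ G K L ^ n := by
  induction n with
  | zero =>
    intro u hu
    rw [pow_zero] at hu
    obtain ⟨c, rfl⟩ := Submodule.mem_one.1 hu
    rw [Algebra.commutes, sub_self]; exact zero_mem _
  | succ n ih =>
    intro u hu
    rw [pow_succ'] at hu
    induction hu using Submodule.mul_induction_on' with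
    | mem_mul_mem m hm v hv =>
      have e : m * v * ι K y - ι K y * (m * v) = m * (v * ι K y - ι K y * v) + 
        (m * ι K y - ι K y * m) * v := by noncomm_ring
      rw [e, pow_succ']
      refine add_mem (Submodule.mul_mem_mul hm (ih v hv)) (Submodule.mul_mem_mul ?_ hv)
      obtain ⟨c, x, rfl⟩ := mem_G K L hm
      have : (algebraMap K U c + ι K x) * ι K y - ι K y * (algebraMap K U c + ι K x) = ι K ⁅x, y⁆ := by
        rw [LieHom.map_lie, Ring.lie_def, add_mul, mul_add, Algebra.commutes]; abel
      rw [this]; exact ι_mem_G K L _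
    | add a _ b _ ha hb =>
      have := add_mem ha hb
      convert this using 1; noncomm_ring

def P (n : ℕ) : Submodule K (U ⊗[K] U) :=
  Submodule.span K {s | ∃ i j u v, i + j = n ∧ u ∈ G K L ^ i ∧ v ∈ G K L ^ j ∧ s = u ⊗ₜ[K] v}

lemma P_mono (n : ℕ) : P K L n ≤ P K L (n + 1) := by
  refine Submodule.span_mono ?_
  rintro _ ⟨i, j, u, v, h, hu, hv, rfl⟩
  exact ⟨i + 1, j, u, v, by omega, G_mono K L (by omega) hu, hv, rfl⟩

lemma P_mul (y : L) (n : ℕ) (s) (hs : s ∈ P K L n) :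
    (ι K y ⊗ₜ[K] 1 + 1 ⊗ₜ[K] ι K y) * s ∈ P K L (n + 1) := by
  induction hs using Submodule.span_induction with
  | mem s hs =>
    obtain ⟨i, j, u, v, h, hu, hv, rfl⟩ := hs
    rw [add_mul, Algebra.TensorProduct.tmul_mul_tmul, Algebra.TensorProduct.tmul_mul_tmul, one_mul, one_mul]
    refine add_mem (Submodule.subset_span ?_) (Submodule.subset_span ?_)
    · exact ⟨i + 1, j, _, _, by omega, ι_mul_mem K L y hu, hv, rfl⟩
    · exact ⟨i, j + 1, _, _, by omega, hu, ι_mul_mem K L y hv, rfl⟩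
  | zero => simp
  | add a b _ _ ha hb => rw [mul_add]; exact add_mem ha hb
  | smul c a _ ha => rw [mul_smul_comm]; exact Submodule.smul_mem _ c ha

lemma P_mul' (y : L) (n : ℕ) (s) (hs : s ∈ P K L n) :
    LinearMap.mul' K U ((ι K y ⊗ₜ[K] 1 + 1 ⊗ₜ[K] ι K y) * s)
      - (2 : K) • (ι K y * LinearMap.mul' K U s) ∈ G K L ^ n := by
  induction hs using Submodule.span_induction with
  | mem s hs =>
    obtain ⟨i, j, u, v, h, hu, hv, rfl⟩ := hs
    rw [add_mul, Algebra.TensorProduct.tmul_mul_tmul, Algebra.TensorProduct.tmul_mul_tmul, one_mul, one_mul,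
      map_add, LinearMap.mul'_apply, LinearMap.mul'_apply, LinearMap.mul'_apply]
    have : ι K y * u * v + u * (ι K y * v) - (2 : K) • (ι K y * (u * v)) =
        (u * ι K y - ι K y * u) * v := by
      rw [two_smul]; noncomm_ring
    rw [this, ← h, pow_add]
    exact Submodule.mul_mem_mul (comm_mem K L y i u hu) hv
  | zero => simp
  | add a b _ _ ha hb => 
    have := add_mem ha hb
    convert this using 1
    simp only [mul_add, map_add, smul_add]; abel
  | smul c a _ ha =>
    have := Submodule.smul_mem _ c ha
    convert this using 1
    simp only [mul_smul_comm, map_smul, smul_sub, smul_comm c (2 : K)]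

def low : ℕ → Submodule K U
  | 0 => ⊥
  | n + 1 => G K L ^ n

lemma low_le (n : ℕ) : low K L n ≤ G K L ^ n := by
  cases n with
  | zero => exact bot_le
  | succ n => exact G_mono K L (by omega)

lemma ι_mul_low (x : L) {n : ℕ} {u : U} (hu : u ∈ low K L n) : ι K x * u ∈ G K L ^ n := by
  cases n with
  | zero => obtain rfl : u = 0 := by simpa [low] using hu
            simp
  | succ n => exact ι_mul_mem K L x hu

lemma main_filt (d : U →ₗ[K] U ⊗[K] U) (h1 : d 1 = 1) (hm : ∀ a b, d (a * b) = d a * d b)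
  (hι : ∀ x : L, d (ι K x) = ι K x ⊗ₜ[K] 1 + 1 ⊗ₜ[K] ι K x)
    (n : ℕ) : ∀ u ∈ G K L ^ n, d u ∈ P K L n ∧
    LinearMap.mul' K U (d u) - (2 : K) ^ n • u ∈ low K L n := by
  induction n with
  | zero =>
    intro u hu
    rw [pow_zero] at hu
    obtain ⟨c, rfl⟩ := Submodule.mem_one.1 hu
    rw [Algebra.algebraMap_eq_smul_one, map_smul, h1]
    constructor
    · refine Submodule.smul_mem _ _ (Submodule.subset_span ⟨0, 0, 1, 1, rfl, ?_, ?_, rfl⟩) <;>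
      · rw [pow_zero]; exact Submodule.mem_one.2 ⟨1, map_one _⟩
    · simp [Algebra.TensorProduct.one_def]
  | succ n ih =>
    intro u hu
    rw [pow_succ'] at hu
    induction hu using Submodule.mul_induction_on' with
    | mem_mul_mem m hm' v hv =>
      obtain ⟨c, y, rfl⟩ := mem_G K L hm'
      obtain ⟨ih1, ih2⟩ := ih v hv
      have e : d ((algebraMap K U c + ι K y) * v) = 
          c • d v + (ι K y ⊗ₜ[K] 1 + 1 ⊗ₜ[K] ι K y) * d v := by
        rw [add_mul, map_add, hm (ι K y), hι, ← Algebra.smul_def, map_smul]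
      constructor
      · rw [e]
        exact add_mem (Submodule.smul_mem _ _ (P_mono K L n ih1)) (P_mul K L y n _ ih1)
      · have h3 := P_mul' K L y n _ ih1
        rw [e]
        change _ ∈ G K L ^ n
        have h4 := Submodule.smul_mem _ c (low_le K L n ih2)
        have h5 := Submodule.smul_mem _ (c * 2 ^ n) hv
        have h6 := Submodule.smul_mem _ (2 : K) (ι_mul_low K L y ih2)
        convert add_mem (sub_mem (add_mem h3 h4) h5) h6 using 1
        rw [add_mul (algebraMap K U c), ← Algebra.smul_def, map_add, map_smul, mul_sub, mul_smul_comm]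
        module
    | add a _ b _ ha hb =>
      refine ⟨by rw [map_add]; exact add_mem ha.1 hb.1, ?_⟩
      convert add_mem ha.2 hb.2 using 1
      simp only [map_add, smul_add]; abel

lemma prim [CharZero K] (d : U →ₗ[K] U ⊗[K] U) (h1 : d 1 = 1) (hm : ∀ a b, d (a * b) = d a * d b)
  (hι : ∀ x : L, d (ι K x) = ι K x ⊗ₜ[K] 1 + 1 ⊗ₜ[K] ι K x)
    (a : U) (ha : d a = a ⊗ₜ[K] 1 + 1 ⊗ₜ[K] a) : a ∈ G K L := by
  obtain ⟨n, hn⟩ := exhaust K L a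
  induction n with
  | zero => rw [← pow_one (G K L)]; exact G_mono K L zero_le_one hn
  | succ n ih =>
    rcases n with _ | n
    · simpa using hn
    · apply ih
      have h := (main_filt K L d h1 hm hι _ a hn).2
      rw [ha, map_add, LinearMap.mul'_apply, LinearMap.mul'_apply, mul_one, one_mul] at h
      change _ ∈ G K L ^ (n + 1) at h
      have e : a + a - (2 : K) ^ (n + 1 + 1) • a = (2 - 2 ^ (n + 2) : K) • a := by module
      rw [e] at h
      have h0 : (2 - 2 ^ (n + 2) : K) ≠ 0 := by
        rw [sub_ne_zero]
        have : (2 : ℕ) ≠ 2 ^ (n + 2) := by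
          have := Nat.one_le_two_pow (n := n); rw [pow_add]; omega
        exact_mod_cast this
      exact (Submodule.smul_mem_iff _ h0).1 h

end MM
end Prim


/-- **Milnor–Moore theorem, full faithfulness on morphisms.**
Let `K` be a field of characteristic zero and let `L₁`, `L₂` be Lie algebras over `K`,
with each universal enveloping algebra carrying its standard bialgebra structure
(encoded by a hypothesized coalgebra structure whose comultiplication and counit are
algebra homomorphisms and which satisfies `comul (ι x) = ι x ⊗ 1 + 1 ⊗ ι x` and
`counit (ι x) = 0`; these conditions determine the bialgebra structure uniquely).
Then for every `K`-algebra homomorphism `φ : U(L₁) → U(L₂)` commuting with the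
comultiplications and counits (i.e. every bialgebra homomorphism), there exists a unique
Lie algebra homomorphism `f : L₁ → L₂` such that `φ ∘ ι = ι ∘ f`. -/
theorem milnor_moore_fully_faithful
    (K : Type*) [Field K] [CharZero K]
    (L₁ : Type*) [LieRing L₁] [LieAlgebra K L₁]
    (L₂ : Type*) [LieRing L₂] [LieAlgebra K L₂]
    [Coalgebra K (UniversalEnvelopingAlgebra K L₁)]
    [Coalgebra K (UniversalEnvelopingAlgebra K L₂)]
    (hcounit_one₁ : Coalgebra.counit (R := K) (1 : UniversalEnvelopingAlgebra K L₁) = 1)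
    (hcounit_mul₁ : ∀ a b : UniversalEnvelopingAlgebra K L₁,
      Coalgebra.counit (R := K) (a * b) =
        Coalgebra.counit (R := K) a * Coalgebra.counit (R := K) b)
    (hcomul_one₁ : Coalgebra.comul (R := K) (1 : UniversalEnvelopingAlgebra K L₁) = 1)
    (hcomul_mul₁ : ∀ a b : UniversalEnvelopingAlgebra K L₁,
      Coalgebra.comul (R := K) (a * b) =
        Coalgebra.comul (R := K) a * Coalgebra.comul (R := K) b)
    (hcomul₁ : ∀ x : L₁,
      Coalgebra.comul (R := K) (UniversalEnvelopingAlgebra.ι K x) =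
        UniversalEnvelopingAlgebra.ι K x ⊗ₜ[K] 1 + 1 ⊗ₜ[K] UniversalEnvelopingAlgebra.ι K x)
    (hcounit₁ : ∀ x : L₁,
      Coalgebra.counit (R := K) (UniversalEnvelopingAlgebra.ι K x) = 0)
    (hcounit_one₂ : Coalgebra.counit (R := K) (1 : UniversalEnvelopingAlgebra K L₂) = 1)
    (hcounit_mul₂ : ∀ a b : UniversalEnvelopingAlgebra K L₂,
      Coalgebra.counit (R := K) (a * b) =
        Coalgebra.counit (R := K) a * Coalgebra.counit (R := K) b)
    (hcomul_one₂ : Coalgebra.comul (R := K) (1 : UniversalEnvelopingAlgebra K L₂) = 1)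
    (hcomul_mul₂ : ∀ a b : UniversalEnvelopingAlgebra K L₂,
      Coalgebra.comul (R := K) (a * b) =
        Coalgebra.comul (R := K) a * Coalgebra.comul (R := K) b)
    (hcomul₂ : ∀ x : L₂,
      Coalgebra.comul (R := K) (UniversalEnvelopingAlgebra.ι K x) =
        UniversalEnvelopingAlgebra.ι K x ⊗ₜ[K] 1 + 1 ⊗ₜ[K] UniversalEnvelopingAlgebra.ι K x)
    (hcounit₂ : ∀ x : L₂,
      Coalgebra.counit (R := K) (UniversalEnvelopingAlgebra.ι K x) = 0)
    (φ : UniversalEnvelopingAlgebra K L₁ →ₐ[K] UniversalEnvelopingAlgebra K L₂)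
    (hφ_comul : ∀ a : UniversalEnvelopingAlgebra K L₁,
      Coalgebra.comul (R := K) (φ a) =
        TensorProduct.map φ.toLinearMap φ.toLinearMap (Coalgebra.comul (R := K) a))
    (hφ_counit : ∀ a : UniversalEnvelopingAlgebra K L₁,
      Coalgebra.counit (R := K) (φ a) = Coalgebra.counit (R := K) a) :
    ∃! f : L₁ →ₗ⁅K⁆ L₂,
      ∀ x : L₁, φ (UniversalEnvelopingAlgebra.ι K x) =
        UniversalEnvelopingAlgebra.ι K (f x) := by
  have hinj := MM.ι_injective K L₂
  have hex : ∀ x : L₁, ∃ y : L₂, φ (UniversalEnvelopingAlgebra.ι K x) =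
      UniversalEnvelopingAlgebra.ι K y := by
    intro x
    have hp : Coalgebra.comul (R := K) (φ (UniversalEnvelopingAlgebra.ι K x)) =
        φ (UniversalEnvelopingAlgebra.ι K x) ⊗ₜ[K] 1 +
          1 ⊗ₜ[K] φ (UniversalEnvelopingAlgebra.ι K x) := by
      rw [hφ_comul, hcomul₁, map_add, TensorProduct.map_tmul, TensorProduct.map_tmul]
      simp only [AlgHom.toLinearMap_apply, map_one]
    obtain ⟨c, y, hy⟩ := MM.mem_G K L₂
      (MM.prim K L₂ Coalgebra.comul hcomul_one₂ hcomul_mul₂ hcomul₂ _ hp)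
    refine ⟨y, ?_⟩
    have hc := hφ_counit (UniversalEnvelopingAlgebra.ι K x)
    rw [hcounit₁, hy, map_add, hcounit₂, Algebra.algebraMap_eq_smul_one, map_smul,
      hcounit_one₂] at hc
    have hc0 : c = 0 := by simpa using hc
    rw [hy, hc0, map_zero, zero_add]
  choose f hf using hex
  refine ⟨{ toFun := f, map_add' := ?_, map_smul' := ?_, map_lie' := ?_ }, hf, ?_⟩
  · intro x y
    apply hinj
    rw [← hf, map_add, map_add, map_add, hf, hf]
  · intro c x
    apply hinj
    rw [← hf, map_smul, map_smul, RingHom.id_apply, map_smul, hf]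
  · intro x y
    apply hinj
    change UniversalEnvelopingAlgebra.ι K (f ⁅x, y⁆) = UniversalEnvelopingAlgebra.ι K ⁅f x, f y⁆
    rw [← hf, MM.ι_lie, MM.ι_lie, map_sub, map_mul, map_mul,
      hf, hf]
  · intro g hg
    ext x
    apply hinj
    rw [← hg, hf]
    rfl
end
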